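/- arXiv:1406.4807 — 2 statements merged into one kernel-verified Lean document; each statement's English description precedes it below -/
import Mathlib

section
/- Let X = {0,1}^ℕ with the product topology and let Φ : X → X be the dyadic odometer. Then Φ is a homeomorphism of X, it preserves the uniform product (Bernoulli) measure ⊗_{i ∈ ℕ}(½δ_0 + ½δ_1), and this measure is the unique Φ-invariant Borel probability measure on X. -/
open MeasureTheory Filter Topology
open scoped ENNReal

/-- The `p`-adic odometer on `{0, …, p-1}^ℕ`: addition of `1` in base `p` with carry
to the right.  The constant sequence `p-1` is sent to the constant sequence `0`;
otherwise, if `n` is the least index with `x n ≠ p - 1`, all coordinates before `n`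
become `0`, the `n`-th coordinate is increased by one, and the rest are unchanged. -/
noncomputable def odometer (p : ℕ) (hp : 0 < p) (x : ℕ → Fin p) : ℕ → Fin p := by
  classical
  exact if h : ∃ n, (x n).val ≠ p - 1 then
    fun i =>
      if i < Nat.find h then ⟨0, hp⟩
      else if hi : i = Nat.find h then
        ⟨(x i).val + 1, by
          have h1 := (x (Nat.find h)).isLt
          have h2 := Nat.find_spec h
          subst hi
          omega⟩
      else x i
  else fun _ => ⟨0, hp⟩

/-- The natural number whose first `n` binary digits are `x 0, …, x (n - 1)`. -/
def binaryPrefix (n : ℕ) (x : ℕ → Fin 2) : ℕ := ∑ i ∈ Finset.range n, (x i).val * 2 ^ i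

theorem binaryPrefix_succ (n : ℕ) (x : ℕ → Fin 2) :
    binaryPrefix (n + 1) x = binaryPrefix n x + (x n).val * 2 ^ n :=
  Finset.sum_range_succ _ _

theorem binaryPrefix_lt (n : ℕ) (x : ℕ → Fin 2) : binaryPrefix n x < 2 ^ n := by
  induction n with
  | zero => simp [binaryPrefix]
  | succ n ih =>
    have h : (x n).val * 2 ^ n ≤ 1 * 2 ^ n := Nat.mul_le_mul_right _ (by omega)
    rw [binaryPrefix_succ, pow_succ]
    omega

theorem binaryPrefix_eq_iff {n : ℕ} {x y : ℕ → Fin 2} :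
    binaryPrefix n x = binaryPrefix n y ↔ ∀ i, i < n → x i = y i := by
  refine ⟨fun h => ?_, fun h => Finset.sum_congr rfl fun i hi => by rw [h i (by simpa using hi)]⟩
  induction n with
  | zero => simp
  | succ n ih =>
    have hx := binaryPrefix_lt n x
    have hy := binaryPrefix_lt n y
    rw [binaryPrefix_succ, binaryPrefix_succ] at h
    have hxy : x n = y n := by
      generalize x n = a at h ⊢
      generalize y n = b at h ⊢
      fin_cases a <;> fin_cases b <;> simp at h ⊢ <;> omega
    rw [hxy, Nat.add_right_cancel_iff] at h
    intro i hi
    rcases Nat.lt_succ_iff_lt_or_eq.1 hi with hi | rfl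
    exacts [ih h i hi, hxy]

theorem natCast_binaryPrefix_eq_iff {n : ℕ} {x y : ℕ → Fin 2} :
    (binaryPrefix n x : ZMod (2 ^ n)) = binaryPrefix n y ↔ ∀ i, i < n → x i = y i := by
  rw [ZMod.natCast_eq_natCast_iff', Nat.mod_eq_of_lt (binaryPrefix_lt n x),
    Nat.mod_eq_of_lt (binaryPrefix_lt n y), binaryPrefix_eq_iff]

theorem odometer_two_apply (x : ℕ → Fin 2) (i : ℕ) :
    odometer 2 two_pos x i = if ∀ j, j < i → x j = 1 then x i + 1 else x i := by
  have hne (n : ℕ) : (x n).val ≠ 2 - 1 ↔ x n ≠ 1 := by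
    generalize x n = a
    fin_cases a <;> simp
  unfold odometer
  by_cases h : ∃ n, (x n).val ≠ 2 - 1
  · rw [dif_pos h]
    have hspec : x (Nat.find h) ≠ 1 := (hne _).1 (Nat.find_spec h)
    have hmin (j : ℕ) (hj : j < Nat.find h) : x j = 1 :=
      not_not.1 fun hj' => Nat.find_min h hj ((hne j).2 hj')
    have hall : (∀ j, j < i → x j = 1) ↔ i ≤ Nat.find h :=
      ⟨fun hi => not_lt.1 fun hlt => hspec (hi _ hlt), fun hi j hj => hmin j (hj.trans_le hi)⟩
    simp only [hall]
    rcases lt_trichotomy i (Nat.find h) with hi | hi | hi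
    · simp [hi, hi.le, hmin i hi]
    · have h0 : x i = 0 := by
        rw [← hi] at hspec
        omega
      simp [← hi, h0]
    · simp [hi.not_gt, hi.ne', hi.not_ge]
  · rw [dif_neg h]
    have hone (j : ℕ) : x j = 1 := not_not.1 fun hj => h ⟨j, (hne j).2 hj⟩
    simp [hone]

theorem binaryPrefix_odometer (n : ℕ) (x : ℕ → Fin 2) :
    (binaryPrefix n (odometer 2 two_pos x) : ZMod (2 ^ n)) = binaryPrefix n x + 1 := by
  have key : binaryPrefix n (odometer 2 two_pos x) +
      (if ∀ j, j < n → x j = 1 then 2 ^ n else 0) = binaryPrefix n x + 1 := by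
    induction n with
    | zero => simp [binaryPrefix]
    | succ n ih =>
      have hiff : (∀ j, j < n + 1 → x j = 1) ↔ (∀ j, j < n → x j = 1) ∧ x n = 1 :=
        Nat.forall_lt_succ_right
      rw [binaryPrefix_succ, binaryPrefix_succ, odometer_two_apply]
      simp only [hiff]
      generalize x n = a
      by_cases h : ∀ j, j < n → x j = 1
      · rw [if_pos h] at ih
        simp only [if_pos h, and_iff_right h]
        fin_cases a <;> simp [pow_succ] <;> omega
      · simp only [h, if_false, false_and] at ih ⊢
        omega
  have h := congrArg (Nat.cast : ℕ → ZMod (2 ^ n)) key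
  have h2 : ((2 : ZMod (2 ^ n)) ^ n) = 0 := by exact_mod_cast ZMod.natCast_self (2 ^ n)
  push_cast at h
  rwa [h2, ite_self, add_zero] at h

theorem binaryPrefix_odometer_iterate (n k : ℕ) (x : ℕ → Fin 2) :
    (binaryPrefix n ((odometer 2 two_pos)^[k] x) : ZMod (2 ^ n)) = binaryPrefix n x + k := by
  induction k with
  | zero => simp
  | succ k ih =>
    rw [Function.iterate_succ_apply', binaryPrefix_odometer, ih]
    push_cast
    ring

theorem continuous_odometer_two : Continuous (odometer 2 two_pos) := by
  refine continuous_pi fun i => ?_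
  refine IsLocallyConstant.continuous ((IsLocallyConstant.iff_exists_open _).2 fun x => ?_)
  refine ⟨PiNat.cylinder x (i + 1), PiNat.isOpen_cylinder _ x _, PiNat.self_mem_cylinder x _,
    fun y hy => natCast_binaryPrefix_eq_iff.1 ?_ i (Nat.lt_succ_self i)⟩
  rw [binaryPrefix_odometer, binaryPrefix_odometer, natCast_binaryPrefix_eq_iff.2 hy]

theorem odometer_two_injective : Function.Injective (odometer 2 two_pos) := by
  intro x y h
  funext i
  refine natCast_binaryPrefix_eq_iff.1 ?_ i (Nat.lt_succ_self i)
  apply add_right_cancel (b := 1)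
  rw [← binaryPrefix_odometer, ← binaryPrefix_odometer, h]

theorem odometer_two_surjective : Function.Surjective (odometer 2 two_pos) := by
  rw [← Set.range_eq_univ, ← (isCompact_range continuous_odometer_two).isClosed.closure_eq,
    ← dense_iff_closure_eq, (PiNat.isTopologicalBasis_cylinders _).dense_iff]
  rintro _ ⟨y, n, rfl⟩ -
  refine ⟨_, natCast_binaryPrefix_eq_iff.1 ?_, (odometer 2 two_pos)^[2 ^ n - 1] y, rfl⟩
  have h2 : ((2 ^ n : ℕ) : ZMod (2 ^ n)) = 0 := ZMod.natCast_self _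
  rw [← Function.iterate_succ_apply' (odometer 2 two_pos), binaryPrefix_odometer_iterate, Nat.succ_eq_add_one,
    Nat.sub_add_cancel Nat.one_le_two_pow, h2, add_zero]

/-- The dyadic odometer as a homeomorphism. -/
noncomputable def dyadicOdometerHomeomorph : (ℕ → Fin 2) ≃ₜ (ℕ → Fin 2) :=
  Continuous.homeoOfEquivCompactToT2
    (f := Equiv.ofBijective _ ⟨odometer_two_injective, odometer_two_surjective⟩)
    continuous_odometer_two

/-- A probability measure on `{0,1}^ℕ` is determined by its values on
cylinders. -/
theorem ext_of_cylinder {μ ν : Measure (ℕ → Fin 2)} [IsProbabilityMeasure μ]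
    [IsProbabilityMeasure ν] (h : ∀ s n, μ (PiNat.cylinder s n) = ν (PiNat.cylinder s n)) :
    μ = ν := by
  have hbasis := PiNat.isTopologicalBasis_cylinders (fun _ : ℕ => Fin 2)
  refine ext_of_generate_finite _
    ((BorelSpace.measurable_eq).trans hbasis.borel_eq_generateFrom) ?_ ?_ (by simp)
  · rintro _ ⟨x, m, rfl⟩ _ ⟨y, n, rfl⟩ ⟨z, hzx, hzy⟩
    rw [← PiNat.mem_cylinder_iff_eq.1 hzx, ← PiNat.mem_cylinder_iff_eq.1 hzy]
    rcases le_total m n with hmn | hmn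
    · exact ⟨z, n, Set.inter_eq_right.2 (PiNat.cylinder_anti z hmn)⟩
    · exact ⟨z, m, Set.inter_eq_left.2 (PiNat.cylinder_anti z hmn)⟩
  · rintro _ ⟨x, n, rfl⟩
    exact h x n

theorem measurableSet_binaryPrefix_eq (n : ℕ) (a : ZMod (2 ^ n)) :
    MeasurableSet {x | (binaryPrefix n x : ZMod (2 ^ n)) = a} := by
  have h : Measurable (binaryPrefix n) := by
    unfold binaryPrefix
    fun_prop
  exact h (MeasurableSet.of_discrete (s := {k : ℕ | (k : ZMod (2 ^ n)) = a}))

theorem cylinder_eq_binaryPrefix (s : ℕ → Fin 2) (n : ℕ) :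
    PiNat.cylinder s n = {x | (binaryPrefix n x : ZMod (2 ^ n)) = binaryPrefix n s} :=
  Set.ext fun _ => natCast_binaryPrefix_eq_iff.symm

theorem preimage_odometer_cylinder (s : ℕ → Fin 2) (n : ℕ) :
    odometer 2 two_pos ⁻¹' PiNat.cylinder (odometer 2 two_pos s) n = PiNat.cylinder s n := by
  ext x
  simp only [cylinder_eq_binaryPrefix, Set.mem_preimage, Set.mem_ofPred_eq, binaryPrefix_odometer,
    add_left_inj]

/-- An odometer-invariant probability measure gives each cylinder of length `n` mass `2⁻ⁿ`. -/
theorem measure_cylinder_of_measurePreserving_odometer {ν : Measure (ℕ → Fin 2)}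
    [IsProbabilityMeasure ν] (hν : MeasurePreserving (odometer 2 two_pos) ν ν)
    (s : ℕ → Fin 2) (n : ℕ) : ν (PiNat.cylinder s n) = (2 : ℝ≥0∞)⁻¹ ^ n := by
  let F (a : ZMod (2 ^ n)) : Set (ℕ → Fin 2) := {x | (binaryPrefix n x : ZMod (2 ^ n)) = a}
  have hF (a : ZMod (2 ^ n)) : MeasurableSet (F a) := measurableSet_binaryPrefix_eq n a
  have hstep (a : ZMod (2 ^ n)) : ν (F (a + 1)) = ν (F a) := by
    rw [← hν.measure_preimage (hF _).nullMeasurableSet]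
    congr 1
    ext x
    simp [F, binaryPrefix_odometer]
  have hconst (a : ZMod (2 ^ n)) : ν (F a) = ν (F 0) := by
    obtain ⟨k, rfl⟩ := ZMod.natCast_zmod_surjective a
    induction k with
    | zero => simp
    | succ k ih => rw [Nat.cast_succ, hstep, ih]
  have hsum : ∑ a, ν (F a) = 1 := by
    have h := sum_measure_preimage_singleton (μ := ν) Finset.univ
      (f := fun x => (binaryPrefix n x : ZMod (2 ^ n))) fun a _ => hF a
    rwa [Finset.coe_univ, Set.preimage_univ, measure_univ] at h
  have hmul : (2 : ℝ≥0∞) ^ n * ν (F 0) = 1 := by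
    simpa [hconst, ZMod.card] using hsum
  rw [cylinder_eq_binaryPrefix, ← ENNReal.inv_pow]
  change ν (F _) = _
  rw [hconst]
  exact ENNReal.eq_inv_of_mul_eq_one_left (by rwa [mul_comm])

/-- The uniform product measure on `{0,1}^ℕ`. -/
noncomputable def bernoulliMeasure : Measure (ℕ → Fin 2) :=
  Measure.infinitePi fun _ => (PMF.uniformOfFintype (Fin 2)).toMeasure

instance : IsProbabilityMeasure bernoulliMeasure := by
  unfold bernoulliMeasure
  infer_instance

theorem bernoulliMeasure_cylinder (s : ℕ → Fin 2) (n : ℕ) :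
    bernoulliMeasure (PiNat.cylinder s n) = (2 : ℝ≥0∞)⁻¹ ^ n := by
  have h : PiNat.cylinder s n = Set.pi (Finset.range n) fun i => {s i} := by
    ext x
    simp [PiNat.cylinder]
  rw [h, bernoulliMeasure, Measure.infinitePi_pi _ fun _ _ => MeasurableSet.singleton _]
  simp

theorem measurePreserving_odometer_bernoulliMeasure :
    MeasurePreserving (odometer 2 two_pos) bernoulliMeasure bernoulliMeasure := by
  have hm : Measurable (odometer 2 two_pos) := continuous_odometer_two.measurable
  have := Measure.isProbabilityMeasure_map (μ := bernoulliMeasure) hm.aemeasurable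
  refine ⟨hm, ext_of_cylinder fun s n => ?_⟩
  obtain ⟨t, rfl⟩ := odometer_two_surjective s
  rw [Measure.map_apply hm (PiNat.isOpen_cylinder _ _ _).measurableSet,
    preimage_odometer_cylinder, bernoulliMeasure_cylinder, bernoulliMeasure_cylinder]

/-- **The dyadic odometer is a uniquely ergodic homeomorphism.**  The dyadic odometer
`Φ` on `X = {0,1}^ℕ` is a homeomorphism, it preserves the uniform product (Bernoulli)
measure (characterized by giving each cylinder on the first `n` coordinates the mass
`2⁻ⁿ`), and this measure is the unique `Φ`-invariant Borel probability measure. -/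
theorem dyadic_odometer_homeomorph_uniquely_ergodic :
    (∃ h : (ℕ → Fin 2) ≃ₜ (ℕ → Fin 2), ⇑h = odometer 2 two_pos) ∧
    ∃ μ : Measure (ℕ → Fin 2), IsProbabilityMeasure μ ∧
      (∀ (n : ℕ) (s : ℕ → Fin 2),
          μ {x : ℕ → Fin 2 | ∀ i, i < n → x i = s i} = (2 : ℝ≥0∞)⁻¹ ^ n) ∧
      MeasurePreserving (odometer 2 two_pos) μ μ ∧
      ∀ ν : Measure (ℕ → Fin 2), IsProbabilityMeasure ν →
        MeasurePreserving (odometer 2 two_pos) ν ν → ν = μ := by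
  refine ⟨⟨dyadicOdometerHomeomorph, rfl⟩, bernoulliMeasure, inferInstance,
    fun n s => bernoulliMeasure_cylinder s n, measurePreserving_odometer_bernoulliMeasure,
    fun ν _ hinv => ext_of_cylinder fun s n => ?_⟩
  rw [measure_cylinder_of_measurePreserving_odometer hinv, bernoulliMeasure_cylinder]
end

section
/- The Van der Corput map R̄ preserves Lebesgue measure on [0,1], and Lebesgue measure is the unique R̄-invariant Borel probability measure on [0,1]; in particular, R̄ is ergodic with respect to Lebesgue measure. -/
open MeasureTheory Filter Topology
open scoped ENNReal

namespace VanDerCorput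

open unitInterval Set

/-- The doubling map `x ↦ 2x`, truncated to the unit interval. -/
noncomputable def double (x : I) : I := projIcc 0 1 zero_le_one (2 * (x : ℝ))

/-- The map `x ↦ 2x - 1`, truncated to the unit interval. -/
noncomputable def doubleSubOne (x : I) : I := projIcc 0 1 zero_le_one (2 * (x : ℝ) - 1)

lemma coe_double {x : I} (hx : (x : ℝ) ≤ 1 / 2) : (double x : ℝ) = 2 * x := by
  have := x.2.1
  rw [double, projIcc_of_mem zero_le_one ⟨by linarith, by linarith⟩]

lemma coe_doubleSubOne {x : I} (hx : 1 / 2 ≤ (x : ℝ)) :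
    (doubleSubOne x : ℝ) = 2 * x - 1 := by
  have := x.2.2
  rw [doubleSubOne, projIcc_of_mem zero_le_one ⟨by linarith, by linarith⟩]

lemma measurable_double : Measurable double :=
  (continuous_projIcc.comp (by fun_prop)).measurable

lemma measurable_doubleSubOne : Measurable doubleSubOne :=
  (continuous_projIcc.comp (by fun_prop)).measurable

/-- The left half `[0, 1/2)` of the unit interval. -/
def leftHalf : Set I := {x | (x : ℝ) < 1 / 2}

/-- The right half `[1/2, 1]` of the unit interval. -/
def rightHalf : Set I := {x | 1 / 2 ≤ (x : ℝ)}

lemma measurableSet_leftHalf : MeasurableSet leftHalf :=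
  measurableSet_lt measurable_subtype_coe measurable_const

lemma measurableSet_rightHalf : MeasurableSet rightHalf :=
  measurableSet_le measurable_const measurable_subtype_coe

/-- The copy of `A` scaled into `[0, 1/2)`. -/
def leftCopy (A : Set I) : Set I := double ⁻¹' A ∩ leftHalf

/-- The copy of `A` scaled into `[1/2, 1]`. -/
def rightCopy (A : Set I) : Set I := doubleSubOne ⁻¹' A ∩ rightHalf

lemma measurableSet_leftCopy {A : Set I} (hA : MeasurableSet A) : MeasurableSet (leftCopy A) :=
  (measurable_double hA).inter measurableSet_leftHalf

lemma measurableSet_rightCopy {A : Set I} (hA : MeasurableSet A) : MeasurableSet (rightCopy A) :=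
  (measurable_doubleSubOne hA).inter measurableSet_rightHalf

lemma disjoint_leftCopy_rightCopy (A B : Set I) : Disjoint (leftCopy A) (rightCopy B) := by
  rw [Set.disjoint_left]
  rintro x ⟨-, hx⟩ ⟨-, hx'⟩
  exact (show (x : ℝ) < 1 / 2 from hx).not_ge hx'

lemma leftCopy_univ_union_rightCopy_univ : leftCopy univ ∪ rightCopy univ = univ := by
  ext x
  simpa [leftCopy, rightCopy, leftHalf, rightHalf] using lt_or_ge (x : ℝ) 2⁻¹

lemma leftCopy_Iic_double {t : I} (ht : (t : ℝ) < 1 / 2) : leftCopy (Iic (double t)) = Iic t := by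
  ext x
  simp only [leftCopy, leftHalf, mem_inter_iff, mem_preimage, mem_Iic, mem_ofPred_eq,
    ← Subtype.coe_le_coe]
  constructor
  · rintro ⟨h, hx⟩
    rw [coe_double hx.le, coe_double ht.le] at h
    linarith
  · intro h
    have hx : (x : ℝ) < 1 / 2 := h.trans_lt ht
    rw [coe_double hx.le, coe_double ht.le]
    exact ⟨by linarith, hx⟩

lemma leftCopy_union_rightCopy_Iic {t : I} (ht : 1 / 2 ≤ (t : ℝ)) :
    leftCopy univ ∪ rightCopy (Iic (doubleSubOne t)) = Iic t := by
  ext x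
  simp only [leftCopy, leftHalf, rightCopy, rightHalf, mem_union, mem_inter_iff, mem_preimage,
    mem_Iic, mem_ofPred_eq, ← Subtype.coe_le_coe, mem_univ, true_and]
  constructor
  · rintro (hx | ⟨h, hx⟩)
    · linarith
    · rw [coe_doubleSubOne hx, coe_doubleSubOne ht] at h
      linarith
  · intro h
    rcases lt_or_ge (x : ℝ) (1 / 2) with hx | hx
    · exact .inl hx
    · rw [coe_doubleSubOne hx, coe_doubleSubOne ht]
      exact .inr ⟨by linarith, hx⟩

lemma measure_Iic_of_half_le (ν : Measure I) [IsFiniteMeasure ν] {t : I} (ht : 1 / 2 ≤ (t : ℝ)) :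
    ν.real (Iic t) = ν.real (leftCopy univ) + ν.real (rightCopy (Iic (doubleSubOne t))) := by
  rw [← leftCopy_union_rightCopy_Iic ht, measureReal_union (disjoint_leftCopy_rightCopy _ _)
    (measurableSet_rightCopy measurableSet_Iic)]

lemma volume_real_Iic (t : I) : (volume : Measure I).real (Iic t) = t := by
  rw [Measure.real, unitInterval.volume_Iic, ENNReal.toReal_ofReal t.2.1]

lemma ext_of_real_Iic {μ ν : Measure I} [IsFiniteMeasure μ] [IsFiniteMeasure ν]
    (h : ∀ t, μ.real (Iic t) = ν.real (Iic t)) : μ = ν :=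
  Measure.ext_of_Iic _ _ fun t ↦ (measureReal_eq_measureReal_iff).1 (h t)

/-- The measure `A ↦ 2 ν (leftCopy A)`. -/
noncomputable def leftMeasure (ν : Measure I) : Measure I :=
  (2 : ℝ≥0∞) • (ν.restrict leftHalf).map double

/-- The measure `A ↦ 2 ν (rightCopy A)`. -/
noncomputable def rightMeasure (ν : Measure I) : Measure I :=
  (2 : ℝ≥0∞) • (ν.restrict rightHalf).map doubleSubOne

lemma leftMeasure_apply (ν : Measure I) {A : Set I} (hA : MeasurableSet A) :
    leftMeasure ν A = 2 * ν (leftCopy A) := by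
  rw [leftMeasure, Measure.smul_apply, Measure.map_apply measurable_double hA,
    Measure.restrict_apply (measurable_double hA), smul_eq_mul, leftCopy]

lemma rightMeasure_apply (ν : Measure I) {A : Set I} (hA : MeasurableSet A) :
    rightMeasure ν A = 2 * ν (rightCopy A) := by
  rw [rightMeasure, Measure.smul_apply, Measure.map_apply measurable_doubleSubOne hA,
    Measure.restrict_apply (measurable_doubleSubOne hA), smul_eq_mul, rightCopy]

lemma leftMeasure_real (ν : Measure I) {A : Set I} (hA : MeasurableSet A) :
    (leftMeasure ν).real A = 2 * ν.real (leftCopy A) := by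
  simp [Measure.real, leftMeasure_apply ν hA]

lemma rightMeasure_real (ν : Measure I) {A : Set I} (hA : MeasurableSet A) :
    (rightMeasure ν).real A = 2 * ν.real (rightCopy A) := by
  simp [Measure.real, rightMeasure_apply ν hA]

instance (ν : Measure I) [IsFiniteMeasure ν] : IsFiniteMeasure (leftMeasure ν) :=
  ⟨by rw [leftMeasure_apply ν .univ]
      exact ENNReal.mul_lt_top ENNReal.ofNat_lt_top (measure_lt_top _ _)⟩

instance (ν : Measure I) [IsFiniteMeasure ν] : IsFiniteMeasure (rightMeasure ν) :=
  ⟨by rw [rightMeasure_apply ν .univ]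
      exact ENNReal.mul_lt_top ENNReal.ofNat_lt_top (measure_lt_top _ _)⟩

lemma volume_real_leftCopy_univ : (volume : Measure I).real (leftCopy univ) = 1 / 2 := by
  have : leftCopy univ = Iio (⟨1 / 2, by norm_num, by norm_num⟩ : I) := by
    ext x
    simp [leftCopy, leftHalf, ← Subtype.coe_lt_coe]
  rw [this, Measure.real, unitInterval.volume_Iio, ENNReal.toReal_ofReal (by norm_num)]

lemma leftMeasure_volume : leftMeasure volume = volume := by
  refine ext_of_real_Iic fun t ↦ ?_
  rw [leftMeasure_real _ measurableSet_Iic, volume_real_Iic]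
  rcases t.2.2.eq_or_lt with ht | ht
  · have : Iic t = univ := by
      ext x
      simpa [← Subtype.coe_le_coe, ht] using x.2.2
    rw [this, volume_real_leftCopy_univ, ht]
    norm_num
  · have h0 := t.2.1
    let s : I := ⟨t / 2, by linarith, by linarith⟩
    have hs : (s : ℝ) < 1 / 2 := by simp only [s]; linarith
    have : t = double s := Subtype.ext (by rw [coe_double hs.le]; simp only [s]; ring)
    rw [this, leftCopy_Iic_double hs, volume_real_Iic, coe_double hs.le]

lemma rightMeasure_volume : rightMeasure volume = volume := by
  refine ext_of_real_Iic fun t ↦ ?_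
  rw [rightMeasure_real _ measurableSet_Iic, volume_real_Iic]
  have h0 := t.2.1
  have h1 := t.2.2
  let s : I := ⟨(t + 1) / 2, by linarith, by linarith⟩
  have hs : 1 / 2 ≤ (s : ℝ) := by simp only [s]; linarith
  have ht : t = doubleSubOne s :=
    Subtype.ext (by rw [coe_doubleSubOne hs]; simp only [s]; ring)
  have := measure_Iic_of_half_le volume hs
  rw [volume_real_leftCopy_univ, volume_real_Iic] at this
  rw [ht, coe_doubleSubOne hs]
  linarith

lemma volume_real_leftCopy {A : Set I} (hA : MeasurableSet A) :
    (volume : Measure I).real (leftCopy A) = (volume : Measure I).real A / 2 := by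
  have := leftMeasure_real volume hA
  rw [leftMeasure_volume] at this
  linarith

lemma volume_real_rightCopy {A : Set I} (hA : MeasurableSet A) :
    (volume : Measure I).real (rightCopy A) = (volume : Measure I).real A / 2 := by
  have := rightMeasure_real volume hA
  rw [rightMeasure_volume] at this
  linarith

/-- A family of functions whose distance to the identity is uniformly bounded and is controlled
by half the distance of another member of the family consists of the identity only. -/
lemma eq_coe_of_halving {ι : Type*} (F : ι → I → ℝ) (hF : ∀ i t, |F i t - t| ≤ 1)
    (h : ∀ i t, ∃ j s, |F i t - t| ≤ |F j s - s| / 2) (i : ι) (t : I) : F i t = t := by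
  have key : ∀ n : ℕ, ∀ i t, |F i t - t| ≤ (1 / 2) ^ n := by
    intro n
    induction n with
    | zero => simpa using hF
    | succ n ih =>
      intro i t
      obtain ⟨j, s, hjs⟩ := h i t
      have := ih j s
      rw [pow_succ]
      linarith
  have hlim : Tendsto (fun n : ℕ ↦ (1 / 2 : ℝ) ^ n) atTop (𝓝 0) :=
    tendsto_pow_atTop_nhds_zero_of_lt_one (by norm_num) (by norm_num)
  have := ge_of_tendsto' hlim fun n ↦ key n i t
  exact sub_eq_zero.1 (abs_eq_zero.1 (this.antisymm (abs_nonneg _)))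

lemma abs_measureReal_sub_coe_le_one (ν : Measure I) [IsProbabilityMeasure ν] (A : Set I) (t : I) :
    |ν.real A - t| ≤ 1 := by
  have h0 := t.2.1
  have h1 := t.2.2
  have h2 : 0 ≤ ν.real A := measureReal_nonneg
  have h3 : ν.real A ≤ 1 := measureReal_le_one
  rw [abs_le]
  constructor <;> linarith

/-- The self-similar description of the Van der Corput map. -/
structure IsSelfSimilar (R : I → I) : Prop where
  apply_left : ∀ x : I, (x : ℝ) < 1 / 2 → (R x : ℝ) = x + 1 / 2
  apply_right : ∀ x : I, 1 / 2 ≤ (x : ℝ) → (R x : ℝ) = R (doubleSubOne x) / 2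
  lt_one : ∀ x : I, (R x : ℝ) < 1

namespace IsSelfSimilar

lemma preimage_leftCopy {R : I → I} (h : IsSelfSimilar R) (A : Set I) :
    R ⁻¹' leftCopy A = rightCopy (R ⁻¹' A) := by
  ext x
  simp only [leftCopy, leftHalf, rightCopy, rightHalf, mem_inter_iff, mem_preimage, mem_ofPred_eq]
  rcases lt_or_ge (x : ℝ) (1 / 2) with hx | hx
  · have := h.apply_left x hx
    have := x.2.1
    constructor
    · rintro ⟨-, h'⟩
      linarith
    · rintro ⟨-, h'⟩
      linarith
  · have h1 := h.apply_right x hx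
    have h2 := h.lt_one (doubleSubOne x)
    have h3 : (R x : ℝ) < 1 / 2 := by linarith
    have h4 : double (R x) = R (doubleSubOne x) :=
      Subtype.ext (by rw [coe_double h3.le, h1]; ring)
    simp only [h4, h3, hx]

lemma preimage_rightCopy {R : I → I} (h : IsSelfSimilar R) (A : Set I) :
    R ⁻¹' rightCopy A = leftCopy A := by
  ext x
  simp only [leftCopy, leftHalf, rightCopy, rightHalf, mem_inter_iff, mem_preimage, mem_ofPred_eq]
  rcases lt_or_ge (x : ℝ) (1 / 2) with hx | hx
  · have h1 := h.apply_left x hx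
    have h2 := x.2.1
    have h3 : 1 / 2 ≤ (R x : ℝ) := by linarith
    have h4 : doubleSubOne (R x) = double x :=
      Subtype.ext (by rw [coe_doubleSubOne h3, coe_double hx.le, h1]; ring)
    simp only [h4, h3, hx]
  · have h1 := h.apply_right x hx
    have h2 := h.lt_one (doubleSubOne x)
    constructor
    · rintro ⟨-, h'⟩
      linarith
    · rintro ⟨-, h'⟩
      linarith

lemma measurable {R : I → I} (h : IsSelfSimilar R) : Measurable R := by
  let f : ℕ → I → ℝ := fun n ↦ Nat.rec (fun _ ↦ 0)
    (fun _ g x ↦ if (x : ℝ) < 1 / 2 then (x : ℝ) + 1 / 2 else g (doubleSubOne x) / 2) n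
  have hf : ∀ n, Measurable (f n) := by
    intro n
    induction n with
    | zero => exact measurable_const
    | succ n ih =>
      exact Measurable.ite measurableSet_leftHalf (by fun_prop)
        ((ih.comp measurable_doubleSubOne).div_const 2)
  have hfR : ∀ n x, |f n x - R x| ≤ (1 / 2) ^ n := by
    intro n
    induction n with
    | zero =>
      intro x
      have hz : f 0 x = 0 := rfl
      rw [hz, zero_sub, abs_neg, pow_zero, abs_of_nonneg (R x).2.1]
      exact (R x).2.2
    | succ n ih =>
      intro x
      have hs : f (n + 1) x =
        if (x : ℝ) < 1 / 2 then (x : ℝ) + 1 / 2 else f n (doubleSubOne x) / 2 := rfl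
      rw [hs]
      split_ifs with hx
      · rw [h.apply_left x hx, sub_self, abs_zero]
        positivity
      · rw [h.apply_right x (not_lt.1 hx), ← sub_div, abs_div, abs_two, pow_succ]
        have := ih (doubleSubOne x)
        linarith
  have hlim : Tendsto f atTop (𝓝 fun x ↦ (R x : ℝ)) := by
    refine tendsto_pi_nhds.2 fun x ↦ ?_
    rw [tendsto_iff_dist_tendsto_zero]
    exact squeeze_zero (fun _ ↦ dist_nonneg) (fun n ↦ hfR n x)
      (tendsto_pow_atTop_nhds_zero_of_lt_one (by norm_num) (by norm_num))
  exact (measurable_of_tendsto_metrizable hf hlim).subtype_mk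

lemma measurePreserving_volume {R : I → I} (h : IsSelfSimilar R) :
    MeasurePreserving R volume volume := by
  refine ⟨h.measurable, ?_⟩
  have := Measure.isProbabilityMeasure_map (μ := (volume : Measure I)) h.measurable.aemeasurable
  refine ext_of_real_Iic fun t ↦ ?_
  rw [volume_real_Iic]
  refine eq_coe_of_halving (fun (_ : Unit) t ↦ ((volume : Measure I).map R).real (Iic t))
    (fun _ t ↦ abs_measureReal_sub_coe_le_one _ _ t) (fun _ t ↦ ?_) () t
  rcases lt_or_ge (t : ℝ) (1 / 2) with ht | ht
  · refine ⟨(), double t, le_of_eq ?_⟩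
    simp only [map_measureReal_apply h.measurable measurableSet_Iic]
    rw [← leftCopy_Iic_double ht, h.preimage_leftCopy,
      volume_real_rightCopy (h.measurable measurableSet_Iic), coe_double ht.le, ← abs_two,
      ← abs_div, abs_two]
    ring_nf
  · refine ⟨(), t, ?_⟩
    have hA := measurableSet_rightCopy (measurableSet_Iic (a := doubleSubOne t))
    have : ((volume : Measure I).map R).real (Iic t) - t = 0 := by
      rw [measure_Iic_of_half_le _ ht, map_measureReal_apply h.measurable hA,
        map_measureReal_apply h.measurable (measurableSet_leftCopy .univ), h.preimage_leftCopy,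
        h.preimage_rightCopy, preimage_univ, volume_real_rightCopy .univ,
        volume_real_leftCopy measurableSet_Iic, volume_real_Iic, coe_doubleSubOne ht,
        probReal_univ]
      ring
    simp [this]

lemma measure_real_rightCopy {R : I → I} (h : IsSelfSimilar R)
    {ν : Measure I} (hν : MeasurePreserving R ν ν) {A : Set I}
    (hA : MeasurableSet A) : ν.real (rightCopy A) = ν.real (leftCopy A) := by
  rw [← h.preimage_rightCopy,
    hν.measureReal_preimage (measurableSet_rightCopy hA).nullMeasurableSet]

lemma measurePreserving_leftMeasure {R : I → I} (h : IsSelfSimilar R)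
    {ν : Measure I} (hν : MeasurePreserving R ν ν) :
    MeasurePreserving R (leftMeasure ν) (leftMeasure ν) := by
  refine ⟨h.measurable, Measure.ext fun A hA ↦ ?_⟩
  rw [Measure.map_apply h.measurable hA, leftMeasure_apply ν hA,
    leftMeasure_apply ν (h.measurable hA), ← h.preimage_rightCopy, ← h.preimage_leftCopy,
    hν.measure_preimage (h.measurable (measurableSet_leftCopy hA)).nullMeasurableSet,
    hν.measure_preimage (measurableSet_leftCopy hA).nullMeasurableSet]

lemma real_leftCopy_univ {R : I → I} (h : IsSelfSimilar R)
    {ν : Measure I} [IsProbabilityMeasure ν]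
    (hν : MeasurePreserving R ν ν) : ν.real (leftCopy univ) = 1 / 2 := by
  have h1 := measureReal_union (μ := ν) (disjoint_leftCopy_rightCopy univ univ)
    (measurableSet_rightCopy .univ)
  rw [leftCopy_univ_union_rightCopy_univ, probReal_univ,
    h.measure_real_rightCopy hν .univ] at h1
  linarith

lemma isProbabilityMeasure_leftMeasure {R : I → I} (h : IsSelfSimilar R)
    {ν : Measure I} [IsProbabilityMeasure ν]
    (hν : MeasurePreserving R ν ν) : IsProbabilityMeasure (leftMeasure ν) := by
  rw [isProbabilityMeasure_iff_real, leftMeasure_real ν .univ, h.real_leftCopy_univ hν]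
  norm_num

lemma eq_volume {R : I → I} (h : IsSelfSimilar R)
    {ν : Measure I} [IsProbabilityMeasure ν] (hν : MeasurePreserving R ν ν) :
    ν = volume := by
  refine ext_of_real_Iic fun t ↦ ?_
  rw [volume_real_Iic]
  let ι := {μ : Measure I // IsProbabilityMeasure μ ∧ MeasurePreserving R μ μ}
  refine eq_coe_of_halving (fun (μ : ι) t ↦ μ.1.real (Iic t)) ?_ ?_ ⟨ν, ‹_›, hν⟩ t
  · rintro ⟨μ, _, -⟩ t
    exact abs_measureReal_sub_coe_le_one _ _ t
  · rintro ⟨μ, _, hμ⟩ t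
    let μ' : ι := ⟨leftMeasure μ, h.isProbabilityMeasure_leftMeasure hμ,
      h.measurePreserving_leftMeasure hμ⟩
    rcases lt_or_ge (t : ℝ) (1 / 2) with ht | ht
    · refine ⟨μ', double t, le_of_eq ?_⟩
      simp only [μ']
      rw [leftMeasure_real _ measurableSet_Iic, leftCopy_Iic_double ht, coe_double ht.le,
        ← mul_sub, abs_mul, abs_two]
      ring
    · refine ⟨μ', doubleSubOne t, le_of_eq ?_⟩
      simp only [μ']
      rw [leftMeasure_real _ measurableSet_Iic, measure_Iic_of_half_le _ ht,
        h.real_leftCopy_univ hμ, h.measure_real_rightCopy hμ measurableSet_Iic,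
        coe_doubleSubOne ht, ← abs_two, ← abs_div, abs_two]
      ring_nf

lemma ergodic_volume {R : I → I} (h : IsSelfSimilar R) : Ergodic R volume := by
  refine Ergodic.of_mem_extremePoints ?_
  have : {ν : Measure I | MeasurePreserving R ν ν ∧ IsProbabilityMeasure ν} = {volume} := by
    ext ν
    refine ⟨fun ⟨hν, _⟩ ↦ h.eq_volume hν, ?_⟩
    rintro rfl
    exact ⟨h.measurePreserving_volume, inferInstance⟩
  rw [this, extremePoints_singleton]
  exact mem_singleton _

end IsSelfSimilar

/-- Every point of `[0, 1)` lies in one of the intervals `[1 - 2⁻ⁿ, 1 - 2⁻ⁿ⁻¹)`. -/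
lemma exists_eq_one_sub_add {x : ℝ} (h0 : 0 ≤ x) (h1 : x < 1) :
    ∃ (n : ℕ) (y : ℝ), 0 ≤ y ∧ y < ((2 : ℝ) ^ (n + 1))⁻¹ ∧ x = 1 - ((2 : ℝ) ^ n)⁻¹ + y := by
  obtain ⟨n, hn, hn'⟩ := exists_nat_pow_near_of_lt_one (x := 1 - x) (y := (2 : ℝ)⁻¹)
    (by linarith) (by linarith) (by norm_num) (by norm_num)
  rw [inv_pow] at hn hn'
  refine ⟨n, x - 1 + ((2 : ℝ) ^ n)⁻¹, by linarith, ?_, by ring⟩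
  have : ((2 : ℝ) ^ n)⁻¹ = 2 * ((2 : ℝ) ^ (n + 1))⁻¹ := by
    rw [pow_succ, mul_inv]
    ring
  linarith

lemma isSelfSimilar_of_piecewise (R : I → I)
    (hR : ∀ (n : ℕ) (y : ℝ), 0 ≤ y → y < ((2 : ℝ) ^ (n + 1))⁻¹ →
        ∀ hmem : 1 - ((2 : ℝ) ^ n)⁻¹ + y ∈ I,
          (R ⟨1 - ((2 : ℝ) ^ n)⁻¹ + y, hmem⟩ : ℝ) = ((2 : ℝ) ^ (n + 1))⁻¹ + y)
    (hR1 : ∀ hmem : (1 : ℝ) ∈ I, (R ⟨1, hmem⟩ : ℝ) = 0) : IsSelfSimilar R := by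
  have hR' : ∀ (n : ℕ) (y : ℝ), 0 ≤ y → y < ((2 : ℝ) ^ (n + 1))⁻¹ →
      ∀ x : I, (x : ℝ) = 1 - ((2 : ℝ) ^ n)⁻¹ + y → (R x : ℝ) = ((2 : ℝ) ^ (n + 1))⁻¹ + y := by
    rintro n y h0 h1 ⟨x, hx⟩ rfl
    exact hR n y h0 h1 hx
  have hpow : ∀ n : ℕ, ((2 : ℝ) ^ (n + 1))⁻¹ = ((2 : ℝ) ^ n)⁻¹ / 2 := fun n ↦ by
    rw [pow_succ, mul_inv]
    rfl
  have hone : ∀ x : I, (x : ℝ) = 1 → (R x : ℝ) = 0 := by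
    rintro ⟨x, hx⟩ rfl
    exact hR1 hx
  refine ⟨fun x hx ↦ ?_, fun x hx ↦ ?_, fun x ↦ ?_⟩
  · rw [hR' 0 x x.2.1 (by norm_num at hx ⊢; exact hx) x (by norm_num)]
    norm_num
    ring
  · have hd := coe_doubleSubOne hx
    rcases x.2.2.eq_or_lt with h1 | h1
    · rw [hone x h1, hone (doubleSubOne x) (by rw [hd, h1]; norm_num), zero_div]
    · obtain ⟨n, y, hy0, hy1, hxy⟩ := exists_eq_one_sub_add (doubleSubOne x).2.1
        (by rw [hd]; linarith)
      have h2 := hpow n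
      have h3 := hpow (n + 1)
      rw [hR' n y hy0 hy1 _ hxy, hR' (n + 1) (y / 2) (by linarith) (by linarith) x (by linarith)]
      linarith
  · rcases x.2.2.eq_or_lt with h1 | h1
    · rw [hone x h1]
      exact one_pos
    · obtain ⟨n, y, hy0, hy1, hxy⟩ := exists_eq_one_sub_add x.2.1 h1
      rw [hR' n y hy0 hy1 x hxy]
      have h2 := hpow n
      have h3 : ((2 : ℝ) ^ n)⁻¹ ≤ 1 := inv_le_one_of_one_le₀ (one_le_pow₀ one_le_two)
      linarith

end VanDerCorput

/-- **The Van der Corput map is uniquely ergodic with respect to Lebesgue measure.**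
Let `R : [0,1] → [0,1]` be the Van der Corput map, i.e. `R(1 - 2^{-n} + y) =
2^{-(n+1)} + y` for every `n ≥ 0` and `0 ≤ y < 2^{-(n+1)}`, and `R 1 = 0`.  Then `R`
preserves Lebesgue measure on `[0,1]`, Lebesgue measure is the unique `R`-invariant
Borel probability measure, and in particular `R` is ergodic for Lebesgue measure. -/
theorem vanDerCorput_measurePreserving_uniquelyErgodic
    (R : Set.Icc (0 : ℝ) 1 → Set.Icc (0 : ℝ) 1)
    (hR : ∀ (n : ℕ) (y : ℝ), 0 ≤ y → y < ((2 : ℝ) ^ (n + 1))⁻¹ →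
        ∀ hmem : 1 - ((2 : ℝ) ^ n)⁻¹ + y ∈ Set.Icc (0 : ℝ) 1,
          (R ⟨1 - ((2 : ℝ) ^ n)⁻¹ + y, hmem⟩ : ℝ) = ((2 : ℝ) ^ (n + 1))⁻¹ + y)
    (hR1 : ∀ hmem : (1 : ℝ) ∈ Set.Icc (0 : ℝ) 1, (R ⟨1, hmem⟩ : ℝ) = 0) :
    MeasurePreserving R volume volume ∧
    (∀ ν : Measure (Set.Icc (0 : ℝ) 1), IsProbabilityMeasure ν →
        MeasurePreserving R ν ν → ν = volume) ∧
    Ergodic R volume := by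
  have h := VanDerCorput.isSelfSimilar_of_piecewise R hR hR1
  exact ⟨h.measurePreserving_volume, fun _ _ hν ↦ h.eq_volume hν, h.ergodic_volume⟩
end
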